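/- Fix an integer ℓ > h. Every weight λ ∈ X belongs to the lower closure of exactly one alcove. -/

import Mathlib

/-- A finite reduced crystallographic root system `Φ` spanning the real vector
space `V`, together with a fixed system of positive roots `pos = Φ⁺`.
The coroot of `α` is recorded as the linear functional `coroot α`, so
`coroot α x` is the pairing `⟨x, α∨⟩`. -/
structure RootSystemSetup (V : Type*) [AddCommGroup V] [Module ℝ V] where
  Φ : Finset V
  coroot : V → Module.Dual ℝ V
  span_eq_top : Submodule.span ℝ (Φ : Set V) = ⊤
  zero_notMem : (0 : V) ∉ Φ
  coroot_self : ∀ α ∈ Φ, coroot α α = 2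
  reflect_mem : ∀ α ∈ Φ, ∀ β ∈ Φ, β - coroot α β • α ∈ Φ
  crystallographic : ∀ α ∈ Φ, ∀ β ∈ Φ, ∃ n : ℤ, coroot α β = n
  reduced : ∀ α ∈ Φ, ∀ c : ℝ, c • α ∈ Φ → c = 1 ∨ c = -1
  pos : Finset V
  pos_subset : pos ⊆ Φ
  mem_pos_or : ∀ α ∈ Φ, α ∈ pos ∨ -α ∈ pos
  neg_notMem_pos : ∀ α ∈ pos, -α ∉ pos
  pos_add : ∀ α ∈ pos, ∀ β ∈ pos, α + β ∈ Φ → α + β ∈ pos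

namespace RootSystemSetup

variable {V : Type*} [AddCommGroup V] [Module ℝ V] (S : RootSystemSetup V)

/-- The half-sum of the positive roots. -/
noncomputable def rho : V := (2 : ℝ)⁻¹ • ∑ α ∈ S.pos, α

/-- The (finite) Weyl group `W_f`: the subgroup of linear automorphisms of `V`
generated by the reflections in the roots. -/
def Wf : Subgroup (V ≃ₗ[ℝ] V) :=
  Subgroup.closure {g | ∃ α ∈ S.Φ, ∀ x, g x = x - S.coroot α x • α}

/-- The Coxeter number `h`, i.e. `1 + max_{α ∈ Φ⁺} ⟨ρ, α∨⟩`. -/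
noncomputable def coxeterNumber : ℝ :=
  1 + sSup ((fun α => S.coroot α S.rho) '' (S.pos : Set V))

end RootSystemSetup

/-- A `W_f`-stable full-rank lattice `X ⊆ V` containing the root lattice, all of whose
elements pair integrally with the coroots. -/
structure WeightLattice {V : Type*} [AddCommGroup V] [Module ℝ V]
    (S : RootSystemSetup V) where
  X : AddSubgroup V
  root_mem : ∀ α ∈ S.Φ, α ∈ X
  wf_stable : ∀ w ∈ S.Wf, ∀ x ∈ X, w x ∈ X
  integral : ∀ x ∈ X, ∀ α ∈ S.Φ, ∃ n : ℤ, S.coroot α x = n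
  span_eq_top : Submodule.span ℝ (X : Set V) = ⊤

/-- The alcove (as a subset of `X`) determined by a family of integers `n`
indexed by the positive roots. -/
def RootSystemSetup.alcove {V : Type*} [AddCommGroup V] [Module ℝ V]
    (S : RootSystemSetup V) (L : WeightLattice S) (ℓ : ℤ) (n : V → ℤ) : Set V :=
  {μ | μ ∈ L.X ∧ ∀ α ∈ S.pos,
    ((n α * ℓ : ℤ) : ℝ) < S.coroot α (μ + S.rho) ∧
    S.coroot α (μ + S.rho) < (((n α + 1) * ℓ : ℤ) : ℝ)}

/-- The lower closure of the alcove determined by `n`: the left inequalities are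
relaxed to `≤`. -/
def RootSystemSetup.lowerClosure {V : Type*} [AddCommGroup V] [Module ℝ V]
    (S : RootSystemSetup V) (L : WeightLattice S) (ℓ : ℤ) (n : V → ℤ) : Set V :=
  {μ | μ ∈ L.X ∧ ∀ α ∈ S.pos,
    ((n α * ℓ : ℤ) : ℝ) ≤ S.coroot α (μ + S.rho) ∧
    S.coroot α (μ + S.rho) < (((n α + 1) * ℓ : ℤ) : ℝ)}

namespace RootSystemSetup

variable {V : Type*} [AddCommGroup V] [Module ℝ V] (S : RootSystemSetup V)

/-- The reflection `x ↦ x - ⟨x, α∨⟩ α`. -/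
def refl (α x : V) : V := x - S.coroot α x • α

variable {S} {α β γ : V}

theorem refl_mem (hα : α ∈ S.Φ) (hβ : β ∈ S.Φ) : S.refl α β ∈ S.Φ :=
  S.reflect_mem α hα β hβ

theorem refl_self (hα : α ∈ S.Φ) : S.refl α α = -α := by
  rw [refl, S.coroot_self α hα]; module

theorem neg_mem (hα : α ∈ S.Φ) : -α ∈ S.Φ :=
  refl_self hα ▸ refl_mem hα hα

theorem coroot_refl_self (hα : α ∈ S.Φ) (x : V) : S.coroot α (S.refl α x) = -S.coroot α x := by
  simp only [refl, map_sub, map_smul, smul_eq_mul, S.coroot_self α hα]; ring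

theorem refl_refl (hα : α ∈ S.Φ) (x : V) : S.refl α (S.refl α x) = x := by
  rw [refl, coroot_refl_self hα, refl]; module

/-- The coroot of `s_α β` is `β∨ ∘ s_α`. -/
theorem coroot_refl (hα : α ∈ S.Φ) (hβ : β ∈ S.Φ) (x : V) :
    S.coroot (S.refl α β) x = S.coroot β (S.refl α x) := by
  have hg (y : V) : (S.coroot β - S.coroot β α • S.coroot α) y = S.coroot β (S.refl α y) := by
    simp [refl, mul_comm]
  rw [← hg]
  congr 1
  refine Module.Dual.eq_of_preReflection_mapsTo (x := S.refl α β) S.Φ.finite_toSet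
    S.span_eq_top (S.coroot_self _ (refl_mem hα hβ)) (fun y hy => ?_) ?_ (fun y hy => ?_)
  · exact refl_mem (refl_mem hα hβ) hy
  · rw [hg, refl_refl hα, S.coroot_self β hβ]
  · rw [Module.preReflection_apply, hg]
    have h : y - S.coroot β (S.refl α y) • S.refl α β =
        S.refl α (S.refl β (S.refl α y)) := by
      simp only [refl, map_sub, map_smul, smul_eq_mul, S.coroot_self α hα]
      module
    exact h ▸ refl_mem hα (refl_mem hβ (refl_mem hα hy))

theorem coroot_neg (hα : α ∈ S.Φ) (x : V) : S.coroot (-α) x = -S.coroot α x := by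
  rw [← refl_self hα, coroot_refl hα hα, coroot_refl_self hα]

variable (S) in
/-- The form `(x, y) ↦ ∑ ⟨x, α∨⟩⟨y, α∨⟩`, which is invariant under the Weyl group. -/
noncomputable def form : V →ₗ[ℝ] V →ₗ[ℝ] ℝ :=
  ∑ α ∈ S.Φ, (S.coroot α).smulRight (S.coroot α)

theorem form_apply (x y : V) : S.form x y = ∑ α ∈ S.Φ, S.coroot α x * S.coroot α y := by
  simp [form]

theorem form_comm (x y : V) : S.form x y = S.form y x := by
  simp [form_apply, mul_comm]

theorem form_refl (hα : α ∈ S.Φ) (x y : V) :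
    S.form (S.refl α x) (S.refl α y) = S.form x y := by
  rw [form_apply, form_apply]
  refine Finset.sum_nbij' (S.refl α) (S.refl α) (fun β hβ => refl_mem hα hβ)
    (fun β hβ => refl_mem hα hβ) (fun β _ => refl_refl hα β) (fun β _ => refl_refl hα β) ?_
  intro β hβ
  rw [coroot_refl hα hβ, coroot_refl hα hβ]

theorem two_mul_form (hα : α ∈ S.Φ) (x : V) :
    2 * S.form x α = S.coroot α x * S.form α α := by
  have h := form_refl hα (S.refl α x) α
  rw [refl_refl hα, refl_self hα, refl] at h
  simp only [map_neg, map_sub, map_smul, LinearMap.sub_apply, LinearMap.smul_apply,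
    smul_eq_mul] at h
  linarith

theorem form_self_nonneg (x : V) : 0 ≤ S.form x x := by
  rw [form_apply]
  exact Finset.sum_nonneg fun _ _ => mul_self_nonneg _

theorem form_self_pos (hα : α ∈ S.Φ) : 0 < S.form α α := by
  rw [form_apply]
  refine Finset.sum_pos' (fun _ _ => mul_self_nonneg _) ⟨α, hα, ?_⟩
  rw [S.coroot_self α hα]; norm_num

theorem coroot_eq_zero_of_form_self_eq_zero {x : V} (hx : S.form x x = 0) (hα : α ∈ S.Φ) :
    S.coroot α x = 0 := by
  rw [form_apply, Finset.sum_eq_zero_iff_of_nonneg fun _ _ => mul_self_nonneg _] at hx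
  exact mul_self_eq_zero.mp (hx α hα)

theorem add_eq_zero_of_coroot_add_eq_zero (hα : α ∈ S.Φ) (hβ : β ∈ S.Φ)
    (h : ∀ γ ∈ S.Φ, S.coroot γ (α + β) = 0) : α + β = 0 := by
  obtain ⟨v, hv⟩ : ∃ v, v = α + β := ⟨_, rfl⟩
  rw [← hv] at h ⊢
  obtain rfl : β = v - α := by rw [hv]; abel
  by_contra hne
  have hmem (k : ℕ) : α - (2 * k : ℝ) • v ∈ S.Φ := by
    induction k with
    | zero => simpa using hα
    | succ k ih =>
      convert refl_mem hβ (refl_mem hα ih) using 1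
      have hβα : S.coroot (v - α) α = -2 := by
        have := S.coroot_self _ hβ
        rw [map_sub, h _ hβ] at this
        linarith
      simp only [refl, map_sub, map_smul, smul_eq_mul, S.coroot_self α hα, h _ hα, h _ hβ, hβα]
      push_cast
      module
  refine Set.not_injOn_infinite_finite_image (s := Set.univ)
    (f := fun k : ℕ => α - (2 * k : ℝ) • v) Set.infinite_univ
    (S.Φ.finite_toSet.subset ?_) ?_
  · rintro _ ⟨k, -, rfl⟩
    exact hmem k
  · intro a _ b _ hab
    have := smul_left_injective ℝ hne (sub_right_injective hab)
    simpa using this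

theorem add_mem_of_coroot_neg (hα : α ∈ S.Φ) (hβ : β ∈ S.Φ) (h : S.coroot α β < 0)
    (hne : α + β ≠ 0) : α + β ∈ S.Φ := by
  have hα0 := form_self_pos hα
  have hβ0 := form_self_pos hβ
  have h1 := two_mul_form hα β
  have h2 := two_mul_form hβ α
  rw [form_comm α β] at h2
  obtain ⟨m, hm⟩ := S.crystallographic α hα β hβ
  obtain ⟨n, hn⟩ := S.crystallographic β hβ α hα
  have hm0 : m < 0 := by rw [hm] at h; exact_mod_cast h
  have hn0 : n < 0 := by
    have : S.coroot β α < 0 := by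
      by_contra! hc
      nlinarith [mul_nonneg hc hβ0.le, mul_pos_of_neg_of_neg h (neg_lt_zero.mpr hα0)]
    rw [hn] at this; exact_mod_cast this
  by_cases hm1 : m = -1
  · convert refl_mem hα hβ using 1
    rw [refl, hm, hm1]; push_cast; module
  by_cases hn1 : n = -1
  · convert refl_mem hβ hα using 1
    rw [refl, hn, hn1]; push_cast; module
  refine absurd (add_eq_zero_of_coroot_add_eq_zero hα hβ fun γ hγ =>
    coroot_eq_zero_of_form_self_eq_zero (le_antisymm ?_ (form_self_nonneg _)) hγ) hne
  have hm2 : (m : ℝ) ≤ -2 := by exact_mod_cast (by omega : m ≤ -2)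
  have hn2 : (n : ℝ) ≤ -2 := by exact_mod_cast (by omega : n ≤ -2)
  simp only [map_add, LinearMap.add_apply, form_comm α β]
  rw [hm] at h1
  rw [hn] at h2
  nlinarith [mul_le_mul_of_nonneg_right hm2 hα0.le, mul_le_mul_of_nonneg_right hn2 hβ0.le]

theorem mem_of_mem_pos (hα : α ∈ S.pos) : α ∈ S.Φ := S.pos_subset hα

theorem add_ne_zero_of_mem_pos (hα : α ∈ S.pos) (hβ : β ∈ S.pos) : α + β ≠ 0 := fun h =>
  S.neg_notMem_pos α hα (neg_eq_of_add_eq_zero_right h ▸ hβ)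

theorem add_mem_pos_of_coroot_neg (hα : α ∈ S.pos) (hβ : β ∈ S.pos) (h : S.coroot α β < 0) :
    α + β ∈ S.pos :=
  S.pos_add α hα β hβ <| add_mem_of_coroot_neg (mem_of_mem_pos hα) (mem_of_mem_pos hβ) h
    (add_ne_zero_of_mem_pos hα hβ)

/-- Two positive roots do not add up to a nonpositive multiple of a third one. -/
theorem add_ne_neg_nsmul (hα : α ∈ S.pos) (k : ℕ) : ∀ β ∈ S.pos, ∀ γ ∈ S.pos,
    S.coroot α β = -k → S.coroot α γ = -k → β + γ ≠ -((k : ℝ) • α) := by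
  induction k using Nat.strong_induction_on with
  | _ k ih =>
    intro β hβ γ hγ hβk hγk h
    match k with
    | 0 => exact add_ne_zero_of_mem_pos hβ hγ (by simpa using h)
    | 1 =>
      have hβ' := add_mem_pos_of_coroot_neg hα hβ (by rw [hβk]; norm_num)
      refine add_ne_zero_of_mem_pos hβ' hγ ?_
      rw [add_assoc, h]; simp
    | k + 2 =>
      have hlt : -((k + 2 : ℕ) : ℝ) < 0 := by push_cast; linarith [k.cast_nonneg (α := ℝ)]
      have hα2 := S.coroot_self α (mem_of_mem_pos hα)
      refine ih k (by omega) _ (add_mem_pos_of_coroot_neg hα hβ (hβk ▸ hlt)) _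
        (add_mem_pos_of_coroot_neg hα hγ (hγk ▸ hlt)) ?_ ?_ ?_
      · rw [map_add, hα2, hβk]; push_cast; ring
      · rw [map_add, hα2, hγk]; push_cast; ring
      · rw [add_add_add_comm, h]; push_cast; module

/-- A positive root sent to a negative root by `s_α` pairs positively with `α∨`. -/
theorem coroot_pos_of_refl_notMem (hα : α ∈ S.pos) (hβ : β ∈ S.pos)
    (h : S.refl α β ∉ S.pos) : 0 < S.coroot α β := by
  have hαΦ := mem_of_mem_pos hα
  have hβΦ := mem_of_mem_pos hβ
  by_contra! hle
  have hγ : -S.refl α β ∈ S.pos := (S.mem_pos_or _ (refl_mem hαΦ hβΦ)).resolve_left h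
  obtain ⟨n, hn⟩ := S.crystallographic α hαΦ β hβΦ
  obtain ⟨k, hk⟩ : ∃ k : ℕ, n = -k :=
    ⟨n.natAbs, by have : n ≤ 0 := by (rw [hn] at hle; exact_mod_cast hle)
                  omega⟩
  have hβk : S.coroot α β = -k := by rw [hn, hk]; push_cast; rfl
  refine add_ne_neg_nsmul hα k β hβ _ hγ hβk ?_ ?_
  · rw [map_neg, coroot_refl_self hαΦ, hβk]; ring
  · rw [refl, hβk]; module

variable (S) in
open Classical in
/-- The positive roots sent to negative roots by `s_α`. -/
noncomputable def inversions (α : V) : Finset V := {β ∈ S.pos | S.refl α β ∉ S.pos}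

theorem mem_inversions : β ∈ S.inversions α ↔ β ∈ S.pos ∧ S.refl α β ∉ S.pos := by
  simp [inversions]

theorem self_mem_inversions (hα : α ∈ S.pos) : α ∈ S.inversions α :=
  mem_inversions.mpr ⟨hα, refl_self (mem_of_mem_pos hα) ▸ S.neg_notMem_pos α hα⟩

theorem neg_refl_mem_inversions (hα : α ∈ S.Φ) (hβ : β ∈ S.inversions α) :
    -S.refl α β ∈ S.inversions α := by
  obtain ⟨hβ, h⟩ := mem_inversions.mp hβ
  refine mem_inversions.mpr
    ⟨(S.mem_pos_or _ (refl_mem hα (mem_of_mem_pos hβ))).resolve_left h, ?_⟩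
  have : S.refl α (-S.refl α β) = -β := by
    rw [refl, map_neg, coroot_refl_self hα, refl]; module
  exact this ▸ S.neg_notMem_pos β hβ

open Classical in
theorem two_mul_coroot_rho (hα : α ∈ S.Φ) :
    2 * S.coroot α S.rho = ∑ β ∈ S.inversions α, S.coroot α β := by
  have h0 : ∑ β ∈ S.pos with S.refl α β ∈ S.pos, S.coroot α β = 0 := by
    have : ∑ β ∈ S.pos with S.refl α β ∈ S.pos, S.coroot α β =
        ∑ β ∈ S.pos with S.refl α β ∈ S.pos, -S.coroot α β := by
      refine Finset.sum_nbij' (S.refl α) (S.refl α) ?_ ?_ (fun β _ => refl_refl hα β)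
        (fun β _ => refl_refl hα β) (fun β _ => by rw [coroot_refl_self hα, neg_neg]) <;>
      · intro β hβ
        simp only [Finset.mem_filter, refl_refl hα] at hβ ⊢
        exact hβ.symm
    rw [Finset.sum_neg_distrib] at this
    linarith
  have := Finset.sum_filter_add_sum_filter_not S.pos (fun β => S.refl α β ∈ S.pos) (S.coroot α)
  rw [h0, zero_add] at this
  rw [inversions, this, rho, map_smul, map_sum, smul_eq_mul]
  ring

theorem coroot_rho_pos (hα : α ∈ S.pos) : 0 < S.coroot α S.rho := by
  have h := two_mul_coroot_rho (mem_of_mem_pos hα)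
  have : 0 < ∑ β ∈ S.inversions α, S.coroot α β :=
    Finset.sum_pos (fun β hβ => coroot_pos_of_refl_notMem hα (mem_inversions.mp hβ).1
      (mem_inversions.mp hβ).2) ⟨α, self_mem_inversions hα⟩
  linarith

theorem coroot_rho_smul (hα : α ∈ S.Φ) :
    S.coroot α S.rho • α = ∑ β ∈ S.inversions α, β := by
  have h : ∑ β ∈ S.inversions α, β = ∑ β ∈ S.inversions α, -S.refl α β := by
    have hinv (β : V) : -S.refl α (-S.refl α β) = β := by
      conv_lhs => rw [refl, map_neg, coroot_refl_self hα, refl]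
      module
    refine Finset.sum_nbij' (fun β => -S.refl α β) (fun β => -S.refl α β)
      (fun β hβ => neg_refl_mem_inversions hα hβ) (fun β hβ => neg_refl_mem_inversions hα hβ)
      (fun β _ => hinv β) (fun β _ => hinv β) (fun β _ => (hinv β).symm)
  have h2 : ∑ β ∈ S.inversions α, -S.refl α β =
      (2 * S.coroot α S.rho) • α - ∑ β ∈ S.inversions α, β := by
    rw [two_mul_coroot_rho hα, Finset.sum_smul, ← Finset.sum_sub_distrib]
    exact Finset.sum_congr rfl fun β _ => by rw [refl]; abel
  rw [h2] at h
  generalize ∑ β ∈ S.inversions α, β = σ at h ⊢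
  have h3 : (2 : ℝ) • σ = (2 : ℝ) • (S.coroot α S.rho • α) := by
    rw [two_smul]; nth_rewrite 1 [h]; module
  exact (smul_right_injective V (two_ne_zero (α := ℝ)) h3).symm

theorem coroot_rho_lt (hα : α ∈ S.pos) : S.coroot α S.rho < S.coxeterNumber := by
  have : S.coroot α S.rho ≤ sSup ((fun α => S.coroot α S.rho) '' (S.pos : Set V)) :=
    le_csSup (S.pos.finite_toSet.image _).bddAbove ⟨α, hα, rfl⟩
  rw [coxeterNumber]
  linarith

variable (S) in
theorem coxeterNumber_pos : 0 < S.coxeterNumber := by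
  have : 0 ≤ sSup ((fun α => S.coroot α S.rho) '' (S.pos : Set V)) :=
    Real.sSup_nonneg (by rintro _ ⟨α, hα, rfl⟩; exact (coroot_rho_pos hα).le)
  rw [coxeterNumber]
  linarith

variable (L : WeightLattice S) (ℓ : ℤ)

/-- The points of `ρ + X` on none of the hyperplanes `⟨x, α∨⟩ = m ℓ`. -/
def regularPoints : Set V :=
  {z | z - S.rho ∈ L.X ∧ ∀ α ∈ S.Φ, ∀ m : ℤ, S.coroot α z ≠ m * ℓ}

variable {L ℓ}

theorem rho_mem_regularPoints (hℓ : S.coxeterNumber < (ℓ : ℝ)) :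
    S.rho ∈ regularPoints L ℓ := by
  have key : ∀ α ∈ S.pos, ∀ m : ℤ, S.coroot α S.rho ≠ m * ℓ := by
    intro α hα m h
    have h1 := coroot_rho_pos hα
    have h2 := (coroot_rho_lt hα).trans hℓ
    have hℓ0 : (0 : ℝ) < ℓ := S.coxeterNumber_pos.trans hℓ
    rw [h] at h1 h2
    have hm0 : (0 : ℝ) < m := pos_of_mul_pos_left h1 hℓ0.le
    have hm1 : (m : ℝ) < 1 := by nlinarith
    have : 0 < m := by exact_mod_cast hm0
    have : m < 1 := by exact_mod_cast hm1
    omega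
  refine ⟨by simp [L.X.zero_mem], fun α hα m h => ?_⟩
  rcases S.mem_pos_or α hα with hp | hp
  · exact key α hp m h
  · refine key _ hp (-m) ?_
    rw [coroot_neg hα, h]; push_cast; ring

/-- The regular points are stable under the affine reflections. -/
theorem affine_refl_mem_regularPoints (hα : α ∈ S.Φ) (m : ℤ) {z : V}
    (hz : z ∈ regularPoints L ℓ) :
    z - (S.coroot α z - m * ℓ) • α ∈ regularPoints L ℓ := by
  obtain ⟨hzX, hz⟩ := hz
  refine ⟨?_, fun β hβ k hk => ?_⟩
  · obtain ⟨n, hn⟩ := L.integral _ hzX α hα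
    have : z - (S.coroot α z - m * ℓ) • α - S.rho =
        (z - S.rho) - (n - m * ℓ) • α - S.coroot α S.rho • α := by
      have : S.coroot α z = n + S.coroot α S.rho := by
        rw [map_sub] at hn; linarith
      rw [this, ← Int.cast_smul_eq_zsmul ℝ]; push_cast; module
    rw [this, coroot_rho_smul hα]
    exact L.X.sub_mem (L.X.sub_mem hzX (L.X.zsmul_mem (L.root_mem α hα) _))
      (L.X.sum_mem fun β hβ => L.root_mem β (mem_of_mem_pos (mem_inversions.mp hβ).1))
  · obtain ⟨n, hn⟩ := S.crystallographic β hβ α hα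
    refine hz _ (refl_mem hα hβ) (k - m * n) ?_
    rw [coroot_refl hα hβ, refl]
    simp only [map_sub, map_smul, smul_eq_mul, hn] at hk ⊢
    push_cast
    linarith

theorem form_affine_refl (hα : α ∈ S.Φ) (c : ℝ) (y z : V) :
    S.form (z - (S.coroot α z - c) • α - y) (z - (S.coroot α z - c) • α - y) =
      S.form (z - y) (z - y) - (S.coroot α z - c) * (c - S.coroot α y) * S.form α α := by
  have h := two_mul_form hα (z - y)
  rw [show z - (S.coroot α z - c) • α - y = (z - y) - (S.coroot α z - c) • α by abel]
  generalize hd : z - y = d at h ⊢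
  have hd' : S.coroot α d = S.coroot α z - S.coroot α y := by rw [← hd, map_sub]
  rw [hd'] at h
  simp only [map_sub, map_smul, LinearMap.sub_apply, LinearMap.smul_apply, smul_eq_mul,
    form_comm α d]
  linear_combination (-(S.coroot α z - c)) * h

/-- A nonempty subset of `ρ + X` has a point closest to a given `y`. -/
theorem exists_form_minimal (y : V) {P : Set V} (hP : P.Nonempty)
    (hX : ∀ z ∈ P, z - S.rho ∈ L.X) :
    ∃ z ∈ P, ∀ w ∈ P, S.form (z - y) (z - y) ≤ S.form (w - y) (w - y) := by
  obtain ⟨z₀, hz₀⟩ := hP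
  set q : V → ℝ := fun z => S.form (z - y) (z - y) with hq
  have hfin : (q '' {z ∈ P | q z ≤ q z₀}).Finite := by
    have hq0 : 0 ≤ q z₀ := form_self_nonneg _
    set c : V → ℝ := fun α => S.coroot α (y - S.rho)
    let T : Set (S.Φ → ℤ) := Set.univ.pi fun α =>
      Set.Icc ⌊c α - (q z₀ + 1)⌋ ⌈c α + (q z₀ + 1)⌉
    have hT : T.Finite := Set.Finite.pi fun α => Set.finite_Icc _ _
    refine (hT.image fun n => ∑ α : S.Φ, ((n α : ℝ) - c α) * ((n α : ℝ) - c α)).subset ?_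
    rintro _ ⟨z, ⟨hzP, hz⟩, rfl⟩
    choose n hn using fun α : S.Φ => L.integral _ (hX z hzP) α α.2
    have hnc (α : S.Φ) : (n α : ℝ) - c α = S.coroot α (z - y) := by
      rw [← hn, ← map_sub]; congr 1; abel
    refine ⟨n, fun α _ => ?_, ?_⟩
    · have hle : S.coroot α (z - y) * S.coroot α (z - y) ≤ q z₀ := by
        refine le_trans ?_ hz
        simp only [hq, form_apply]
        exact Finset.single_le_sum (f := fun α => S.coroot α (z - y) * S.coroot α (z - y))
          (fun _ _ => mul_self_nonneg _) α.2
      rw [← hnc] at hle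
      have habs : |(n α : ℝ) - c α| ≤ q z₀ + 1 := abs_le_of_sq_le_sq (by nlinarith) (by linarith)
      obtain ⟨h1, h2⟩ := abs_le.mp habs
      constructor
      · exact_mod_cast (Int.floor_le _).trans (by linarith : c α - (q z₀ + 1) ≤ n α)
      · exact_mod_cast (by linarith : (n α : ℝ) ≤ c α + (q z₀ + 1)).trans (Int.le_ceil _)
    · simp only [hnc, hq, form_apply]
      exact Finset.sum_coe_sort S.Φ fun α => S.coroot α (z - y) * S.coroot α (z - y)
  obtain ⟨_, ⟨z, ⟨hzP, hz⟩, rfl⟩, hmin⟩ :=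
    Set.exists_min_image _ id hfin ⟨_, z₀, ⟨hz₀, le_rfl⟩, rfl⟩
  refine ⟨z, hzP, fun w hw => ?_⟩
  rcases le_total (q w) (q z₀) with h | h
  · exact hmin _ ⟨w, ⟨hw, h⟩, rfl⟩
  · exact hz.trans h

/-- An alcove of the real space `V` contains a point of `ρ + X`. -/
theorem alcove_nonempty (hℓ : S.coxeterNumber < (ℓ : ℝ)) {n : V → ℤ} {y : V}
    (hy : ∀ α ∈ S.pos, (n α * ℓ : ℝ) < S.coroot α y ∧ S.coroot α y < (n α + 1) * ℓ) :
    (S.alcove L ℓ n).Nonempty := by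
  obtain ⟨z, hz, hmin⟩ := exists_form_minimal (L := L) y
    ⟨S.rho, rho_mem_regularPoints (L := L) hℓ⟩ fun z hz => hz.1
  have hsep (α) (hα : α ∈ S.pos) (m : ℤ) :
      (S.coroot α z - m * ℓ) * (m * ℓ - S.coroot α y) ≤ 0 := by
    have hαΦ := mem_of_mem_pos hα
    have h := hmin _ (affine_refl_mem_regularPoints hαΦ m hz)
    rw [form_affine_refl hαΦ] at h
    exact nonpos_of_mul_nonpos_left (by linarith) (form_self_pos hαΦ)
  refine ⟨z - S.rho, hz.1, fun α hα => ?_⟩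
  obtain ⟨h1, h2⟩ := hy α hα
  have hne := hz.2 α (mem_of_mem_pos hα)
  rw [sub_add_cancel]
  push_cast
  constructor
  · refine lt_of_le_of_ne ?_ (hne (n α)).symm
    nlinarith [hsep α hα (n α)]
  · have h3 := hsep α hα (n α + 1)
    have h4 := hne (n α + 1)
    push_cast at h3 h4
    refine lt_of_le_of_ne ?_ h4
    nlinarith

/-- Moving a point of a lower closure slightly in the direction `ρ` lands in the open alcove. -/
theorem exists_mem_open_alcove {n : V → ℤ} {x : V}
    (hx : ∀ α ∈ S.pos, (n α * ℓ : ℝ) ≤ S.coroot α x ∧ S.coroot α x < (n α + 1) * ℓ) :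
    ∃ y, ∀ α ∈ S.pos, (n α * ℓ : ℝ) < S.coroot α y ∧ S.coroot α y < (n α + 1) * ℓ := by
  have h : ∀ᶠ ε : ℝ in nhdsWithin 0 (Set.Ioi 0), ∀ α ∈ S.pos,
      S.coroot α x + ε * S.coroot α S.rho < (n α + 1) * ℓ := by
    refine (Filter.eventually_all_finset _).mpr fun α hα => nhdsWithin_le_nhds ?_
    have hc : ContinuousAt (fun ε : ℝ => S.coroot α x + ε * S.coroot α S.rho) 0 := by fun_prop
    exact hc.eventually_lt continuousAt_const (by simpa using (hx α hα).2)
  obtain ⟨ε, hε, hε0⟩ := (h.and self_mem_nhdsWithin).exists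
  refine ⟨x + ε • S.rho, fun α hα => ?_⟩
  rw [map_add, map_smul, smul_eq_mul]
  exact ⟨by linarith [(hx α hα).1, mul_pos hε0 (coroot_rho_pos hα)], hε α hα⟩

/-- The integers `n_α` of a lower closure containing `μ` are determined by `μ`. -/
theorem eq_floor_of_mem_lowerClosure (hℓ : (0 : ℝ) < ℓ) {n : V → ℤ} {μ : V}
    (hμ : μ ∈ S.lowerClosure L ℓ n) (hα : α ∈ S.pos) :
    n α = ⌊S.coroot α (μ + S.rho) / ℓ⌋ := by
  obtain ⟨h1, h2⟩ := hμ.2 α hα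
  push_cast at h1 h2
  exact (Int.floor_eq_iff.mpr ⟨(le_div_iff₀ hℓ).mpr h1, (div_lt_iff₀ hℓ).mpr h2⟩).symm

theorem alcove_congr {n n' : V → ℤ} (h : ∀ α ∈ S.pos, n α = n' α) :
    S.alcove L ℓ n = S.alcove L ℓ n' := by
  ext μ
  exact and_congr_right fun _ => forall₂_congr fun α hα => by rw [h α hα]

end RootSystemSetup

/-- Fix an integer `ℓ > h`. Every weight `λ ∈ X` belongs to the lower closure of
exactly one alcove. -/
theorem mem_lowerClosure_unique_alcove {V : Type*} [AddCommGroup V] [Module ℝ V]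
    [FiniteDimensional ℝ V] (S : RootSystemSetup V) (L : WeightLattice S)
    (ℓ : ℤ) (hℓ : S.coxeterNumber < (ℓ : ℝ)) (lam : V) (hlam : lam ∈ L.X) :
    ∃! A : Set V, ∃ n : V → ℤ, A = S.alcove L ℓ n ∧ A.Nonempty ∧
      lam ∈ S.lowerClosure L ℓ n := by
  have hℓ0 : (0 : ℝ) < ℓ := S.coxeterNumber_pos.trans hℓ
  let n : V → ℤ := fun α => ⌊S.coroot α (lam + S.rho) / ℓ⌋
  have hn : ∀ α ∈ S.pos, (n α * ℓ : ℝ) ≤ S.coroot α (lam + S.rho) ∧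
      S.coroot α (lam + S.rho) < (n α + 1) * ℓ := fun α _ =>
    ⟨(le_div_iff₀ hℓ0).mp (Int.floor_le _), (div_lt_iff₀ hℓ0).mp (Int.lt_floor_add_one _)⟩
  obtain ⟨y, hy⟩ := RootSystemSetup.exists_mem_open_alcove hn
  refine ⟨S.alcove L ℓ n, ⟨n, rfl, RootSystemSetup.alcove_nonempty hℓ hy, hlam, ?_⟩, ?_⟩
  · exact_mod_cast hn
  · rintro _ ⟨n', rfl, -, hn'⟩
    exact RootSystemSetup.alcove_congr fun α hα =>
      RootSystemSetup.eq_floor_of_mem_lowerClosure hℓ0 hn' hα
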